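/- Let Z[i] be the Gaussian integers. The solutions (X, Y) ∈ Z[i]² of X⁶ + X·Y⁵ + Y⁶ = 1 with X = x₁ + i·x₂, Y = y₁ + i·y₂ and |x₁|, |x₂|, |y₁|, |y₂| ≤ 16 are exactly ±(1,0), ±(1,−1), ±(0,1) (as pairs (X,Y) up to sign, all with x₂ = y₂ = 0). -/

import Mathlib

/-- Bounded universal quantifier, in a form the kernel evaluates quickly. -/
def gAll (p : Nat → Bool) (n : Nat) : Bool :=
  Nat.rec true (fun k ih => cond (p k) ih false) n

theorem gAll_spec (p : Nat → Bool) (n : Nat) (h : gAll p n = true) (k : Nat) (hk : k < n) :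
    p k = true := by
  induction n with
  | zero => omega
  | succ m ih =>
    have h' : cond (p m) (gAll p m) false = true := h
    cases hp : p m with
    | false => rw [hp] at h'; cases h'
    | true =>
      rw [hp] at h'
      rcases Nat.lt_succ_iff_lt_or_eq.mp hk with h1 | h1
      · exact ih h' h1
      · rw [h1]; exact hp

theorem gCond (a b : Bool) (h : cond a b true = true) (ha : a = true) : b = true := by
  subst ha; exact h

/-- The form. -/
def gForm (x y : Nat) : Nat := x ^ 6 + x * y ^ 5 + y ^ 6

/-- Image of `(u - 16) + (v - 16) i` under `i ↦ 1032` modulo `1032 ^ 2 + 1 = 1065025`. -/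
def gEnc (u v : Nat) : Nat := u + 1032 * v + 1048497

/-- The second coordinate, reconstructed from the first, the class modulo 13, and the quotient. -/
def gSnd (c u k : Nat) : Nat := 13 * k + (8 * c + 5 * u) % 13

/-- The known solutions, shifted by 16. -/
def gGood (u v w z : Nat) : Bool :=
  (v.beq 16 && z.beq 16) &&
    ((u.beq 17 && w.beq 16) || (u.beq 15 && w.beq 16) || (u.beq 17 && w.beq 15) ||
      (u.beq 15 && w.beq 17) || (u.beq 16 && w.beq 17) || (u.beq 16 && w.beq 15))

def gTest (u v w z : Nat) : Bool :=
  cond (Nat.beq (gForm (gEnc u v) (gEnc w z) % 1065025) 1) (gGood u v w z) true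

def gInner (c d : Nat) : Bool :=
  gAll (fun u => gAll (fun k => gAll (fun w => gAll (fun l =>
    gTest u (gSnd c u k) w (gSnd d w l)) 3) 33) 3) 33

def gOuter : Bool :=
  gAll (fun c => gAll (fun d =>
    cond (Nat.beq (gForm (c + 1048497) (d + 1048497) % 13) 1) (gInner c d) true) 13) 13

theorem gOuter_true : gOuter = true := by decide +kernel

theorem gForm_modEq {n a b c d : Nat} (h : a ≡ b [MOD n]) (h' : c ≡ d [MOD n]) :
    gForm a c ≡ gForm b d [MOD n] :=
  ((h.pow 6).add (h.mul (h'.pow 5))).add (h'.pow 6)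

theorem gSnd_eq (u v : Nat) : gSnd ((u + 5 * v) % 13) u (v / 13) = v := by
  unfold gSnd; omega

theorem gEnc_mod (u v : Nat) : gEnc u v ≡ (u + 5 * v) % 13 + 1048497 [MOD 13] := by
  unfold gEnc Nat.ModEq; omega

theorem gMain (u v w z : Nat) (hu : u < 33) (hv : v < 33) (hw : w < 33) (hz : z < 33)
    (h : gForm (gEnc u v) (gEnc w z) ≡ 1 [MOD 1065025]) : gGood u v w z = true := by
  have h13 : gForm (gEnc u v) (gEnc w z) ≡ 1 [MOD 13] := h.of_dvd (by norm_num)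
  have e13 := (gForm_modEq (gEnc_mod u v) (gEnc_mod w z)).symm.trans h13
  have a := gAll_spec _ _ (gAll_spec _ _ gOuter_true ((u + 5 * v) % 13) (Nat.mod_lt _ (by norm_num)))
    ((w + 5 * z) % 13) (Nat.mod_lt _ (by norm_num))
  have e1 : Nat.beq (gForm ((u + 5 * v) % 13 + 1048497) ((w + 5 * z) % 13 + 1048497) % 13) 1 = true :=
    (Nat.beq_eq).mpr e13
  have b := gCond _ _ a e1
  unfold gInner at b
  have b := gAll_spec _ _ (gAll_spec _ _ (gAll_spec _ _ (gAll_spec _ _ b u hu)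
    (v / 13) (by omega)) w hw) (z / 13) (by omega)
  rw [gSnd_eq, gSnd_eq] at b
  have e2 : Nat.beq (gForm (gEnc u v) (gEnc w z) % 1065025) 1 = true :=
    Nat.beq_eq.mpr h
  exact gCond _ _ b e2

/-- Reduction of Gaussian integers sending `i` to `1032`. -/
def gHom : GaussianInt →+* ZMod 1065025 :=
  Zsqrtd.lift ⟨1032, by decide +kernel⟩

theorem gHom_apply (X : GaussianInt) (u v : Nat) (hu : X.re = u - 16) (hv : X.im = v - 16) :
    gHom X = ((gEnc u v : Nat) : ZMod 1065025) := by
  have h : gHom X = (X.re : ZMod 1065025) + X.im * 1032 := rfl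
  have hN : ((1065025 : Nat) : ZMod 1065025) = 0 := ZMod.natCast_self _
  rw [h, hu, hv]
  unfold gEnc
  push_cast at hN ⊢
  linear_combination -hN

theorem stmt_10 (X Y : GaussianInt) :
    (X ^ 6 + X * Y ^ 5 + Y ^ 6 = 1 ∧
      |X.re| ≤ 16 ∧ |X.im| ≤ 16 ∧ |Y.re| ≤ 16 ∧ |Y.im| ≤ 16) ↔
      ((X = 1 ∧ Y = 0) ∨ (X = -1 ∧ Y = 0) ∨ (X = 1 ∧ Y = -1) ∨
        (X = -1 ∧ Y = 1) ∨ (X = 0 ∧ Y = 1) ∨ (X = 0 ∧ Y = -1)) := by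
  constructor
  · rintro ⟨h, h1, h2, h3, h4⟩
    rw [abs_le] at h1 h2 h3 h4
    have key : ∀ a : ℤ, -16 ≤ a ∧ a ≤ 16 → ∃ u : ℕ, a = u - 16 ∧ u < 33 := fun a ha =>
      ⟨(a + 16).toNat, by omega, by omega⟩
    obtain ⟨u, hu, hu'⟩ := key _ h1
    obtain ⟨v, hv, hv'⟩ := key _ h2
    obtain ⟨w, hw, hw'⟩ := key _ h3
    obtain ⟨z, hz, hz'⟩ := key _ h4
    have e := congrArg gHom h
    simp only [map_add, map_mul, map_pow, map_one] at e
    rw [gHom_apply X u v hu hv, gHom_apply Y w z hw hz] at e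
    have e' : gForm (gEnc u v) (gEnc w z) ≡ 1 [MOD 1065025] := by
      rw [← ZMod.natCast_eq_natCast_iff]
      unfold gForm
      push_cast
      exact e
    have g := gMain u v w z hu' hv' hw' hz' e'
    simp only [gGood, Bool.and_eq_true, Bool.or_eq_true, Nat.beq_eq] at g
    simp only [Zsqrtd.ext_iff, Zsqrtd.re_one, Zsqrtd.im_one, Zsqrtd.re_zero, Zsqrtd.im_zero,
      Zsqrtd.re_neg, Zsqrtd.im_neg]
    omega
  · rintro (⟨rfl, rfl⟩ | ⟨rfl, rfl⟩ | ⟨rfl, rfl⟩ | ⟨rfl, rfl⟩ | ⟨rfl, rfl⟩ | ⟨rfl, rfl⟩) <;>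
      refine ⟨by ring, ?_⟩ <;> simp
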